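/- Let B be a Bratteli diagram whose tail equivalence relation R on X_B is aperiodic. (a) If μ is a finite R-invariant Borel measure on X_B, then the vectors p^{(n)} = (μ(X_w^{(n)}(ē)))_{w ∈ V_n} (with ē any finite path from v_0 to w) satisfy, for all n ≥ 1: (i) p^{(n)} ∈ C_n^{(∞)} and (ii) F_n^T p^{(n+1)} = p^{(n)}. (b) Conversely, if a sequence of nonnegative vectors p^{(n)} ∈ ℝ_+^{|V_n|} satisfies F_n^T p^{(n+1)} = p^{(n)} for all n ≥ 1, then there exists a non-atomic finite R-invariant Borel measure μ on X_B with μ(X_w^{(n)}(ē)) = p_w^{(n)} for all n ≥ 1, all w ∈ V_n and all finite paths ē from v_0 to w. (c) Such a measure μ is a probability measure if and only if Σ_{w ∈ V_1} h_w^{(1)} p_w^{(1)} = 1, in which case this equality holds for all n ≥ 1. -/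

import Mathlib

open MeasureTheory

/-- A Bratteli diagram. -/
structure BratteliDiagram where
  V : ℕ → Type
  E : ℕ → Type
  fintypeV : ∀ n, Fintype (V n)
  fintypeE : ∀ n, Fintype (E n)
  nonemptyV : ∀ n, Nonempty (V n)
  nonemptyE : ∀ n, Nonempty (E n)
  root_subsingleton : ∀ v w : V 0, v = w
  src : ∀ n, E n → V n
  rng : ∀ n, E n → V (n + 1)
  src_surj : ∀ n, Function.Surjective (src n)
  rng_surj : ∀ n, Function.Surjective (rng n)

attribute [instance] BratteliDiagram.fintypeV BratteliDiagram.fintypeE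
  BratteliDiagram.nonemptyV BratteliDiagram.nonemptyE

namespace BratteliDiagram

variable (B : BratteliDiagram)

instance (n : ℕ) : TopologicalSpace (B.E n) := ⊥

/-- The path space `X_B` of a Bratteli diagram. -/
def PathSpace : Type :=
  { x : ∀ n, B.E n // ∀ n, B.rng n (x n) = B.src (n + 1) (x (n + 1)) }

instance : TopologicalSpace B.PathSpace := by unfold PathSpace; infer_instance

noncomputable instance : MeasurableSpace B.PathSpace := borel _

/-- The vertex at level `n` through which a path passes. -/
def endVtx (n : ℕ) (x : B.PathSpace) : B.V n := B.src n (x.1 n)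

/-- The cylinder set of paths agreeing with `x` on the first `n` edges. -/
def cyl (n : ℕ) (x : B.PathSpace) : Set B.PathSpace := { y | ∀ i < n, y.1 i = x.1 i }

/-- Tail equivalence of paths. -/
def tailEq (x y : B.PathSpace) : Prop := ∃ N, ∀ n, N ≤ n → x.1 n = y.1 n

/-- The tail equivalence relation is aperiodic: all classes are infinite. -/
def TailAperiodic : Prop := ∀ x : B.PathSpace, { y | B.tailEq x y }.Infinite

/-- A measure is invariant for the tail equivalence relation if any two
cylinder sets ending at the same vertex have equal measure. -/
def TailInvariant (μ : Measure B.PathSpace) : Prop :=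
  ∀ (n : ℕ) (x y : B.PathSpace), B.endVtx n x = B.endVtx n y →
    μ (B.cyl n x) = μ (B.cyl n y)

/-- Ergodicity with respect to the tail equivalence relation. -/
def TailErgodic (μ : Measure B.PathSpace) : Prop :=
  ∀ S : Set B.PathSpace, MeasurableSet S →
    (∀ x y, B.tailEq x y → (x ∈ S ↔ y ∈ S)) → μ S = 0 ∨ μ Sᶜ = 0

/-- The type of finite paths from the root vertex to `v`. -/
def FinPathTo : ∀ n, B.V n → Type
  | 0, _ => PUnit
  | n + 1, v => Σ e : { e : B.E n // B.rng n e = v }, FinPathTo n (B.src n e.1)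

/-- The height `h_v^{(n)}`: the number of finite paths from the root to `v`. -/
noncomputable def height (n : ℕ) (v : B.V n) : ℕ := Nat.card (B.FinPathTo n v)

/-- The number of edges from `w ∈ V_n` to `v ∈ V_{n+1}`; the entry `f^{(n)}_{v,w}`
of the incidence matrix `F_n`. -/
noncomputable def edgeCount (n : ℕ) (v : B.V (n + 1)) (w : B.V n) : ℕ :=
  Nat.card { e : B.E n // B.rng n e = v ∧ B.src n e = w }

/-- The incidence matrix `F_n`, as a real matrix. -/
noncomputable def incMat (n : ℕ) : Matrix (B.V (n + 1)) (B.V n) ℝ :=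
  fun v w => (B.edgeCount n v w : ℝ)

end BratteliDiagram

namespace BratteliDiagram

variable (B : BratteliDiagram)

/-- The application of the transposed incidence matrix `F_n^T` to a vector. -/
noncomputable def transApply (n : ℕ) (y : B.V (n + 1) → ℝ) : B.V n → ℝ :=
  (B.incMat n).transpose.mulVec y

/-- `F_k^T F_{k+1}^T ⋯ F_{k+j}^T y`. -/
noncomputable def transApplyDown (k : ℕ) : ∀ j : ℕ, (B.V (k + j + 1) → ℝ) → (B.V k → ℝ)
  | 0, y => B.transApply k y
  | j + 1, y => transApplyDown k j (B.transApply (k + j + 1) y)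

/-- The cone `C_k^{(k+j)} = F_k^T ⋯ F_{k+j}^T (ℝ_+^{V_{k+j+1}})`. -/
def coneDown (k j : ℕ) : Set (B.V k → ℝ) :=
  { p | ∃ y : B.V (k + j + 1) → ℝ, (∀ v, 0 ≤ y v) ∧ B.transApplyDown k j y = p }

/-- The cone `C_k^{(∞)} = ⋂_{n ≥ k} C_k^{(n)}`. -/
def coneInf (k : ℕ) : Set (B.V k → ℝ) := ⋂ j : ℕ, B.coneDown k j

end BratteliDiagram

namespace BratteliDiagram

open Filter Topology

variable (B : BratteliDiagram)

section Paths

/-- The path following the edges of `g` as long as they are composable, and an arbitrary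
outgoing edge otherwise. -/
noncomputable def greedy (g : ∀ n, B.E n) : ∀ n, B.E n
  | 0 => g 0
  | n + 1 =>
    open Classical in
    if B.rng n (greedy g n) = B.src (n + 1) (g (n + 1)) then g (n + 1)
    else (B.src_surj (n + 1) (B.rng n (greedy g n))).choose

/-- `greedy g`, as an element of the path space. -/
noncomputable def greedyPath (g : ∀ n, B.E n) : B.PathSpace :=
  ⟨B.greedy g, fun n => by
    rw [greedy]
    split_ifs with h
    · exact h
    · exact (B.src_surj (n + 1) (B.rng n (B.greedy g n))).choose_spec.symm⟩

variable {B}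

lemma greedy_eq (g : ∀ n, B.E n) (m : ℕ)
    (h : ∀ i < m, B.rng i (g i) = B.src (i + 1) (g (i + 1))) :
    ∀ i ≤ m, B.greedy g i = g i := by
  intro i
  induction i with
  | zero => intro _; rw [greedy]
  | succ i ih =>
    intro hi
    rw [greedy, if_pos]
    rw [ih (by omega)]
    exact h i (by omega)

/-- A path may be rerouted at level `m` through any edge leaving its vertex at that level. -/
lemma exists_reroute (x : B.PathSpace) (m : ℕ) (e : B.E m) (he : B.src m e = B.endVtx m x) :
    ∃ y ∈ B.cyl m x, y.1 m = e := by
  classical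
  have key := greedy_eq (Function.update x.1 m e) m (by
    intro i hi
    rw [Function.update_of_ne (by omega)]
    rcases eq_or_ne (i + 1) m with rfl | h
    · rw [Function.update_self, he]
      exact x.2 i
    · rw [Function.update_of_ne h]
      exact x.2 i)
  refine ⟨B.greedyPath (Function.update x.1 m e), fun i hi => ?_, ?_⟩
  · exact (key i hi.le).trans (Function.update_of_ne hi.ne _ _)
  · exact (key m le_rfl).trans (Function.update_self _ _ _)

lemma endVtx_succ (n : ℕ) (x : B.PathSpace) : B.endVtx (n + 1) x = B.rng n (x.1 n) :=
  (x.2 n).symm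

lemma endVtx_surjective (n : ℕ) : Function.Surjective (B.endVtx n) := by
  induction n with
  | zero =>
    exact fun v => ⟨B.greedyPath fun n => Classical.arbitrary _, B.root_subsingleton _ _⟩
  | succ n ih =>
    intro v
    obtain ⟨e, rfl⟩ := B.rng_surj n v
    obtain ⟨x, hx⟩ := ih (B.src n e)
    obtain ⟨y, -, hy⟩ := exists_reroute x n e hx.symm
    exact ⟨y, by rw [endVtx_succ, hy]⟩

lemma mem_cyl_self (n : ℕ) (x : B.PathSpace) : x ∈ B.cyl n x := fun _ _ => rfl

lemma cyl_zero (x : B.PathSpace) : B.cyl 0 x = Set.univ :=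
  Set.eq_univ_of_forall fun _ _ hi => absurd hi (Nat.not_lt_zero _)

lemma cyl_antitone (x : B.PathSpace) : Antitone fun n => B.cyl n x :=
  fun _ _ hmn _ hy i hi => hy i (hi.trans_le hmn)

lemma iInter_cyl (x : B.PathSpace) : ⋂ n, B.cyl n x = {x} := by
  ext y
  simp only [Set.mem_iInter, Set.mem_singleton_iff]
  constructor
  · intro h
    exact Subtype.ext (funext fun i => h (i + 1) i i.lt_succ_self)
  · rintro rfl n
    exact mem_cyl_self n y

lemma endVtx_eq_of_mem_cyl {n : ℕ} {x y : B.PathSpace} (h : y ∈ B.cyl n x) :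
    B.endVtx n y = B.endVtx n x := by
  cases n with
  | zero => exact B.root_subsingleton _ _
  | succ n => rw [endVtx_succ, endVtx_succ, h n n.lt_succ_self]

/-- The path agreeing with `x` up to level `m` and traversing `e` there, if `e` leaves the vertex
of `x` at level `m`. -/
noncomputable def reroute (x : B.PathSpace) (m : ℕ) (e : B.E m) : B.PathSpace :=
  open Classical in
  if he : B.src m e = B.endVtx m x then (exists_reroute x m e he).choose else x

lemma reroute_mem_cyl (x : B.PathSpace) (m : ℕ) (e : B.E m) (he : B.src m e = B.endVtx m x) :
    reroute x m e ∈ B.cyl m x := by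
  rw [reroute, dif_pos he]
  exact (exists_reroute x m e he).choose_spec.1

lemma reroute_apply (x : B.PathSpace) (m : ℕ) (e : B.E m) (he : B.src m e = B.endVtx m x) :
    (reroute x m e).1 m = e := by
  rw [reroute, dif_pos he]
  exact (exists_reroute x m e he).choose_spec.2

lemma mem_cyl_reroute_iff (x y : B.PathSpace) (m : ℕ) (e : B.E m)
    (he : B.src m e = B.endVtx m x) :
    y ∈ B.cyl (m + 1) (reroute x m e) ↔ y ∈ B.cyl m x ∧ y.1 m = e := by
  constructor
  · intro h
    exact ⟨fun i hi => (h i (by omega)).trans (reroute_mem_cyl x m e he i hi),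
      (h m m.lt_succ_self).trans (reroute_apply x m e he)⟩
  · rintro ⟨h, hm⟩ i hi
    rcases Nat.lt_succ_iff_lt_or_eq.1 hi with hi | rfl
    · exact (h i hi).trans (reroute_mem_cyl x m e he i hi).symm
    · exact hm.trans (reroute_apply x i e he).symm

lemma cyl_eq_biUnion [∀ n, DecidableEq (B.V n)] (x : B.PathSpace) (m : ℕ) :
    B.cyl m x = ⋃ e ∈ Finset.univ.filter (fun e => B.src m e = B.endVtx m x),
      B.cyl (m + 1) (reroute x m e) := by
  ext y
  simp only [Finset.mem_filter, Finset.mem_univ, true_and, Set.mem_iUnion, exists_prop]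
  constructor
  · intro hy
    have he : B.src m (y.1 m) = B.endVtx m x := endVtx_eq_of_mem_cyl hy
    exact ⟨y.1 m, he, (mem_cyl_reroute_iff x y m _ he).2 ⟨hy, rfl⟩⟩
  · rintro ⟨e, he, hy⟩
    exact ((mem_cyl_reroute_iff x y m e he).1 hy).1

end Paths

section Vectors

variable {B}

lemma transApply_apply [∀ n, DecidableEq (B.V n)] (n : ℕ) (q : B.V (n + 1) → ℝ) (w : B.V n) :
    B.transApply n q w = ∑ e with B.src n e = w, q (B.rng n e) := by
  have h (v : B.V (n + 1)) : (B.edgeCount n v w : ℝ) * q v =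
      ∑ e ∈ Finset.univ.filter (fun e => B.src n e = w) with B.rng n e = v, q (B.rng n e) := by
    rw [Finset.sum_congr rfl (g := fun _ => q v) (by simp +contextual), Finset.sum_const,
      nsmul_eq_mul, edgeCount, Nat.card_eq_fintype_card, Fintype.card_subtype,
      Finset.filter_filter]
    simp only [and_comm]
  simp only [transApply, Matrix.mulVec, dotProduct, Matrix.transpose_apply, incMat, h]
  exact Finset.sum_fiberwise _ _ _

instance finite_finPathTo : ∀ (n : ℕ) (v : B.V n), Finite (B.FinPathTo n v)
  | 0, _ => inferInstanceAs (Finite PUnit)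
  | n + 1, v => by
    have (w : B.V n) : Finite (B.FinPathTo n w) := finite_finPathTo n w
    exact inferInstanceAs
      (Finite (Σ e : { e : B.E n // B.rng n e = v }, B.FinPathTo n (B.src n e.1)))

lemma height_zero (v : B.V 0) : B.height 0 v = 1 :=
  Nat.card_unique (α := PUnit)

lemma height_succ [∀ n, DecidableEq (B.V n)] (n : ℕ) (v : B.V (n + 1)) :
    B.height (n + 1) v = ∑ e with B.rng n e = v, B.height n (B.src n e) := by
  have : B.height (n + 1) v =
      ∑ e : { e : B.E n // B.rng n e = v }, B.height n (B.src n e.1) :=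
    Nat.card_sigma (β := fun e : { e : B.E n // B.rng n e = v } => B.FinPathTo n (B.src n e.1))
  rw [this]
  exact (Finset.sum_subtype (Finset.univ.filter fun e => B.rng n e = v) (by simp)
    (fun e => B.height n (B.src n e))).symm

lemma sum_height_mul_eq {p : (n : ℕ) → B.V n → ℝ}
    (hp : ∀ n, B.transApply n (p (n + 1)) = p n) (n : ℕ) (v : B.V 0) :
    ∑ w : B.V n, (B.height n w : ℝ) * p n w = p 0 v := by
  classical
  induction n with
  | zero =>
    have : Unique (B.V 0) := ⟨⟨v⟩, fun w => B.root_subsingleton w v⟩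
    rw [Fintype.sum_eq_single v fun w hw => absurd (B.root_subsingleton w v) hw, height_zero]
    simp
  | succ n ih =>
    rw [← ih]
    calc ∑ w, (B.height (n + 1) w : ℝ) * p (n + 1) w
        = ∑ w, ∑ e with B.rng n e = w,
            (B.height n (B.src n e) : ℝ) * p (n + 1) (B.rng n e) := by
          refine Finset.sum_congr rfl fun w _ => ?_
          rw [height_succ, Nat.cast_sum, Finset.sum_mul]
          refine Finset.sum_congr rfl fun e he => ?_
          rw [(Finset.mem_filter.1 he).2]
      _ = ∑ w, ∑ e with B.src n e = w,
            (B.height n (B.src n e) : ℝ) * p (n + 1) (B.rng n e) := by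
          exact (Finset.sum_fiberwise _ _ _).trans (Finset.sum_fiberwise _ _ _).symm
      _ = ∑ w, (B.height n w : ℝ) * p n w := by
          refine Finset.sum_congr rfl fun w _ => ?_
          rw [← hp n, transApply_apply, Finset.mul_sum]
          refine Finset.sum_congr rfl fun e he => ?_
          rw [(Finset.mem_filter.1 he).2]

lemma transApplyDown_eq {p : (n : ℕ) → B.V n → ℝ}
    (hp : ∀ n, B.transApply n (p (n + 1)) = p n) (k j : ℕ) :
    B.transApplyDown k j (p (k + j + 1)) = p k := by
  induction j with
  | zero => exact hp k
  | succ j ih =>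
    rw [transApplyDown]
    exact (congrArg (B.transApplyDown k j) (hp (k + j + 1))).trans ih

end Vectors

section Topology

instance (n : ℕ) : DiscreteTopology (B.E n) := ⟨rfl⟩

instance : BorelSpace B.PathSpace := ⟨rfl⟩

lemma isEmbedding_val : IsEmbedding (Subtype.val : B.PathSpace → ∀ n, B.E n) :=
  IsEmbedding.subtypeVal

lemma continuous_edge (n : ℕ) : Continuous fun x : B.PathSpace => x.1 n :=
  (continuous_apply n).comp B.isEmbedding_val.continuous

instance : T2Space B.PathSpace := B.isEmbedding_val.t2Space

instance : CompactSpace B.PathSpace := by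
  refine IsClosedEmbedding.compactSpace (f := (Subtype.val : B.PathSpace → ∀ n, B.E n))
    ⟨B.isEmbedding_val, ?_⟩
  have hrange : Set.range (Subtype.val : B.PathSpace → ∀ n, B.E n) =
      ⋂ n, {x | B.rng n (x n) = B.src (n + 1) (x (n + 1))} := by
    ext x
    simp only [Set.mem_iInter, Set.mem_ofPred_eq]
    exact ⟨by rintro ⟨y, rfl⟩; exact y.2, fun h => ⟨⟨x, h⟩, rfl⟩⟩
  refine hrange ▸ isClosed_iInter fun n => ?_
  exact ((isClosed_discrete {q : B.E n × B.E (n + 1) | B.rng n q.1 = B.src (n + 1) q.2}).preimage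
    ((continuous_apply n).prodMk (continuous_apply (n + 1))))

variable {B}

lemma isClopen_cyl (n : ℕ) (x : B.PathSpace) : IsClopen (B.cyl n x) := by
  have : B.cyl n x = ⋂ i ∈ Set.Iio n, (fun y : B.PathSpace => y.1 i) ⁻¹' {x.1 i} := by
    ext y
    simp [cyl]
  rw [this]
  exact (Set.finite_Iio n).isClopen_biInter fun i _ =>
    (isClopen_discrete _).preimage (B.continuous_edge i)

lemma measurableSet_cyl (n : ℕ) (x : B.PathSpace) : MeasurableSet (B.cyl n x) :=
  (isClopen_cyl n x).isOpen.measurableSet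

end Topology

section Measures

variable {B}

lemma measureReal_cyl_eq_sum [∀ n, DecidableEq (B.V n)] (μ : Measure B.PathSpace)
    [IsFiniteMeasure μ] (x : B.PathSpace) (m : ℕ) :
    μ.real (B.cyl m x) =
      ∑ e with B.src m e = B.endVtx m x, μ.real (B.cyl (m + 1) (reroute x m e)) := by
  conv_lhs => rw [cyl_eq_biUnion]
  refine measureReal_biUnion_finset ?_ fun e _ => measurableSet_cyl _ _
  intro e he f hf hef
  simp only [Finset.coe_filter, Finset.mem_univ, true_and, Set.mem_ofPred_eq] at he hf
  refine Set.disjoint_left.2 fun y hy hy' => hef ?_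
  exact ((mem_cyl_reroute_iff x y m e he).1 hy).2.symm.trans
    ((mem_cyl_reroute_iff x y m f hf).1 hy').2

lemma transApply_eq_of_measure {μ : Measure B.PathSpace} [IsFiniteMeasure μ]
    {p : (n : ℕ) → B.V n → ℝ} (hp : ∀ n x, p n (B.endVtx n x) = μ.real (B.cyl n x)) (n : ℕ) :
    B.transApply n (p (n + 1)) = p n := by
  classical
  ext w
  obtain ⟨x, rfl⟩ := endVtx_surjective n w
  rw [transApply_apply, hp, measureReal_cyl_eq_sum]
  refine Finset.sum_congr rfl fun e he => ?_
  rw [← hp, endVtx_succ, reroute_apply x n e (Finset.mem_filter.1 he).2]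

/-- If a finite measure takes the prescribed values on all cylinders of length `n`, it does so on
all shorter cylinders. -/
lemma measureReal_cyl_eq_of_le {μ : Measure B.PathSpace} [IsFiniteMeasure μ]
    {p : (n : ℕ) → B.V n → ℝ} (hp : ∀ n, B.transApply n (p (n + 1)) = p n) {n : ℕ}
    (hμ : ∀ x, μ.real (B.cyl n x) = p n (B.endVtx n x)) {m : ℕ} (hmn : m ≤ n) :
    ∀ x, μ.real (B.cyl m x) = p m (B.endVtx m x) := by
  classical
  induction hmn using Nat.decreasingInduction with
  | self => exact hμ
  | of_succ m _ ih =>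
    intro x
    rw [measureReal_cyl_eq_sum, ← hp m, transApply_apply]
    refine Finset.sum_congr rfl fun e he => ?_
    rw [ih, endVtx_succ, reroute_apply x m e (Finset.mem_filter.1 he).2]

/-- Prescribed nonnegative values on the cylinders of a fixed length are attained by a finite sum
of point masses. -/
lemma exists_measure_cyl_eq (n : ℕ) (q : B.V n → ℝ) (hq : ∀ v, 0 ≤ q v) :
    ∃ μ : Measure B.PathSpace, IsFiniteMeasure μ ∧
      ∀ x, μ.real (B.cyl n x) = q (B.endVtx n x) := by
  classical
  let res : B.PathSpace → ∀ i : Fin n, B.E i := fun x i => x.1 i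
  have res_eq {x y : B.PathSpace} : res y = res x ↔ y ∈ B.cyl n x :=
    ⟨fun h i hi => congrFun h ⟨i, hi⟩, fun h => funext fun i => h i i.2⟩
  let rep : Set.range res → B.PathSpace := fun w => w.2.choose
  have hrep (w : Set.range res) : res (rep w) = w := w.2.choose_spec
  let μ : Measure B.PathSpace :=
    ∑ w, ENNReal.ofReal (q (B.endVtx n (rep w))) • Measure.dirac (rep w)
  have hμ (x : B.PathSpace) : μ (B.cyl n x) = ENNReal.ofReal (q (B.endVtx n x)) := by
    have hx : rep ⟨res x, x, rfl⟩ ∈ B.cyl n x := res_eq.1 (hrep _)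
    simp only [μ, Measure.finsetSum_apply, Measure.smul_apply, smul_eq_mul]
    rw [Finset.sum_eq_single ⟨res x, x, rfl⟩]
    · rw [Measure.dirac_apply' _ (measurableSet_cyl n x), Set.indicator_of_mem hx,
        endVtx_eq_of_mem_cyl hx]
      simp
    · intro w _ hw
      rw [Measure.dirac_apply' _ (measurableSet_cyl n x), Set.indicator_of_notMem, mul_zero]
      intro h
      exact hw (Subtype.ext ((hrep w).symm.trans (res_eq.2 h)))
    · simp
  refine ⟨μ, ⟨?_⟩, fun x => ?_⟩
  · simp only [μ, Measure.finsetSum_apply, Measure.smul_apply, smul_eq_mul]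
    exact ENNReal.sum_lt_top.2 fun w _ => by simp
  · rw [measureReal_def, hμ, ENNReal.toReal_ofReal (hq _)]

lemma _root_.MeasureTheory.FiniteMeasure.continuous_measureReal_of_isClopen {X : Type*}
    [MeasurableSpace X] [TopologicalSpace X] [OpensMeasurableSpace X] {s : Set X}
    (hs : IsClopen s) : Continuous fun μ : FiniteMeasure X => (μ : Measure X).real s := by
  let f : BoundedContinuousFunction X ℝ := BoundedContinuousFunction.ofNormedAddCommGroup
    (s.indicator 1) (continuous_one.indicator (by simp [hs.frontier_eq])) 1
    (fun x => by by_cases h : x ∈ s <;> simp [h])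
  have hf (μ : FiniteMeasure X) : (μ : Measure X).real s = ∫ x, f x ∂(μ : Measure X) :=
    (integral_indicator_one hs.isOpen.measurableSet).symm
  simp only [hf]
  rw [continuous_iff_continuousAt]
  intro μ
  exact FiniteMeasure.tendsto_iff_forall_integral_tendsto.1 tendsto_id f

lemma exists_finiteMeasure_cyl_eq {p : (n : ℕ) → B.V n → ℝ} (hp0 : ∀ n v, 0 ≤ p n v)
    (hp : ∀ n, B.transApply n (p (n + 1)) = p n) :
    ∃ μ : Measure B.PathSpace, IsFiniteMeasure μ ∧
      ∀ n x, μ.real (B.cyl n x) = p n (B.endVtx n x) := by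
  choose μ hfin hμ using fun n => exists_measure_cyl_eq n (p n) (hp0 n)
  obtain ⟨v⟩ := B.nonemptyV 0
  obtain ⟨x₀, -⟩ := endVtx_surjective 0 v
  let ν : ℕ → FiniteMeasure B.PathSpace := fun n => ⟨μ n, hfin n⟩
  let C : NNReal := (p 0 (B.endVtx 0 x₀)).toNNReal
  have hν (n : ℕ) : (ν n).mass ≤ C := by
    have h := measureReal_cyl_eq_of_le hp (hμ n) n.zero_le x₀
    rw [cyl_zero] at h
    exact (Real.le_toNNReal_iff_coe_le (hp0 _ _)).2 h.le
  obtain ⟨ρ, -, hρ⟩ := (isCompact_setOfPred_finiteMeasure_le_of_compactSpace B.PathSpace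
    C).ultrafilter_le_nhds ((hyperfilter ℕ).map ν) (le_principal_iff.2 (mem_map.2 (Eventually.of_forall hν)))
  refine ⟨ρ, inferInstance, fun m x => ?_⟩
  have hlim : Tendsto (fun n => (ν n : Measure B.PathSpace).real (B.cyl m x)) (hyperfilter ℕ)
      (𝓝 ((ρ : Measure B.PathSpace).real (B.cyl m x))) :=
    ((FiniteMeasure.continuous_measureReal_of_isClopen (isClopen_cyl m x)).tendsto ρ).comp hρ
  refine tendsto_nhds_unique hlim (tendsto_const_nhds.congr' ?_)
  have hev : ∀ᶠ n in (hyperfilter ℕ : Filter ℕ), m ≤ n :=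
    Nat.hyperfilter_le_atTop (eventually_ge_atTop m)
  filter_upwards [hev] with n hn
  exact (measureReal_cyl_eq_of_le hp (hμ n) hn x).symm

lemma tendsto_measure_cyl (μ : Measure B.PathSpace) [IsFiniteMeasure μ] (x : B.PathSpace) :
    Tendsto (fun n => μ (B.cyl n x)) atTop (𝓝 (μ {x})) := by
  rw [← iInter_cyl]
  exact tendsto_measure_iInter_atTop (fun n => (measurableSet_cyl n x).nullMeasurableSet)
    (cyl_antitone x) ⟨0, measure_ne_top _ _⟩

lemma TailInvariant.measure_singleton_eq {μ : Measure B.PathSpace} [IsFiniteMeasure μ]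
    (hμ : B.TailInvariant μ) {x y : B.PathSpace} (h : B.tailEq x y) : μ {x} = μ {y} := by
  obtain ⟨N, hN⟩ := h
  refine tendsto_nhds_unique (tendsto_measure_cyl μ x)
    ((tendsto_measure_cyl μ y).congr' ?_)
  filter_upwards [eventually_ge_atTop N] with n hn
  exact (hμ n x y (congrArg (B.src n) (hN n hn))).symm

lemma TailInvariant.noAtoms (haper : B.TailAperiodic) {μ : Measure B.PathSpace}
    [IsFiniteMeasure μ] (hμ : B.TailInvariant μ) : NullSingletonClass μ := by
  refine ⟨fun x => ?_⟩
  by_contra hx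
  exact measure_ne_top μ _
    ((haper x).meas_eq_top ⟨μ {x}, hx, fun y hy => (hμ.measure_singleton_eq hy).le⟩)

end Measures

end BratteliDiagram

/-- **Bezuglyi–Kwiatkowski–Medynets–Solomyak.** Description of finite tail-invariant
measures on a Bratteli diagram with aperiodic tail equivalence relation in terms of
sequences of nonnegative vectors: (a) the vectors of cylinder values of such a measure
satisfy `p^{(n)} ∈ C_n^{(∞)}` and `F_n^T p^{(n+1)} = p^{(n)}`; (b) conversely any such
sequence of nonnegative vectors arises from a non-atomic finite tail-invariant measure;
(c) the measure is a probability measure iff `Σ_w h_w^{(1)} p_w^{(1)} = 1`, in which case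
the same equality holds at every level. -/
theorem tail_invariant_measures_via_vectors
    (B : BratteliDiagram)
    (hCantor : ∀ x : B.PathSpace, ¬IsOpen ({x} : Set B.PathSpace))
    (haper : B.TailAperiodic) :
    (∀ μ : Measure B.PathSpace, IsFiniteMeasure μ → B.TailInvariant μ →
      ∀ p : (n : ℕ) → B.V n → ℝ,
        (∀ (n : ℕ) (x : B.PathSpace), p n (B.endVtx n x) = (μ (B.cyl n x)).toReal) →
        ∀ n : ℕ, 1 ≤ n → p n ∈ B.coneInf n ∧ B.transApply n (p (n + 1)) = p n) ∧
    (∀ p : (n : ℕ) → B.V n → ℝ,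
      (∀ (n : ℕ) (v : B.V n), 0 ≤ p n v) →
      (∀ n : ℕ, 1 ≤ n → B.transApply n (p (n + 1)) = p n) →
      ∃ μ : Measure B.PathSpace, IsFiniteMeasure μ ∧ NoAtoms μ ∧ B.TailInvariant μ ∧
        ∀ n : ℕ, 1 ≤ n → ∀ x : B.PathSpace,
          (μ (B.cyl n x)).toReal = p n (B.endVtx n x)) ∧
    (∀ μ : Measure B.PathSpace, IsFiniteMeasure μ → B.TailInvariant μ →
      ∀ p : (n : ℕ) → B.V n → ℝ,
        (∀ (n : ℕ) (x : B.PathSpace), p n (B.endVtx n x) = (μ (B.cyl n x)).toReal) →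
        ((IsProbabilityMeasure μ ↔ ∑ w : B.V 1, (B.height 1 w : ℝ) * p 1 w = 1) ∧
          (IsProbabilityMeasure μ →
            ∀ n : ℕ, 1 ≤ n → ∑ w : B.V n, (B.height n w : ℝ) * p n w = 1))) := by
  open BratteliDiagram in
  refine ⟨fun μ _ _ p hp n _ => ?_, fun p hp0 hp => ?_, fun μ _ _ p hp => ?_⟩
  · have hT := transApply_eq_of_measure hp
    refine ⟨Set.mem_iInter.2 fun j => ⟨p (n + j + 1), fun v => ?_, transApplyDown_eq hT n j⟩, hT n⟩
    obtain ⟨x, rfl⟩ := endVtx_surjective _ v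
    exact (hp _ x).symm ▸ ENNReal.toReal_nonneg
  · classical
    let q : (n : ℕ) → B.V n → ℝ := fun n => Nat.casesOn n (B.transApply 0 (p 1)) fun n => p (n + 1)
    have hq0 : ∀ n v, 0 ≤ q n v
      | 0, v => (Finset.sum_nonneg fun _ _ => hp0 _ _).trans_eq (transApply_apply 0 (p 1) v).symm
      | n + 1, v => hp0 (n + 1) v
    have hq : ∀ n, B.transApply n (q (n + 1)) = q n
      | 0 => rfl
      | n + 1 => hp (n + 1) (by omega)
    obtain ⟨μ, hfin, hμ⟩ := exists_finiteMeasure_cyl_eq hq0 hq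
    have hinv : B.TailInvariant μ := fun n x y h =>
      (measureReal_eq_measureReal_iff).1 (by rw [hμ, hμ, h])
    refine ⟨μ, hfin, hinv.noAtoms haper, hinv, fun n hn x => ?_⟩
    obtain ⟨n, rfl⟩ := Nat.exists_eq_add_of_le' hn
    exact hμ (n + 1) x
  · obtain ⟨v⟩ := B.nonemptyV 0
    obtain ⟨x, rfl⟩ := endVtx_surjective 0 v
    have hsum (n : ℕ) : ∑ w : B.V n, (B.height n w : ℝ) * p n w = (μ Set.univ).toReal := by
      rw [sum_height_mul_eq (transApply_eq_of_measure hp) n (B.endVtx 0 x), hp, cyl_zero]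
    have hprob : IsProbabilityMeasure μ ↔ (μ Set.univ).toReal = 1 := by
      rw [isProbabilityMeasure_iff, ENNReal.toReal_eq_one_iff]
    exact ⟨by rw [hsum, hprob], fun h n _ => by rw [hsum, hprob.1 h]⟩
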